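/- Define binary strings by a₀ = 1 and a_{n+1} = aₙ āₙ āₙ aₙ aₙ, where x̄ denotes the bitwise complement of x. Let cₙ be the concatenation of 10 copies of aₙ and let ω = c₀c₁c₂c₃…. Then ω is not eventually strongly almost periodic: for every finite string a and strongly almost periodic sequence ν, ω ≠ aν. -/

import Mathlib

/-- The segment of a sequence `ω` of length `l` starting at position `i`,
i.e. the string `ω(i)ω(i+1)…ω(i+l-1)`. -/
def seg {A : Type*} (ω : ℕ → A) (i l : ℕ) : List A :=
  List.ofFn (fun k : Fin l => ω (i + k))

/-- The string `x` occurs in the sequence `ω` starting at position `i`. -/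
def OccursAt {A : Type*} (ω : ℕ → A) (x : List A) (i : ℕ) : Prop :=
  seg ω i x.length = x

/-- A sequence is strongly almost periodic if every string occurring in it
occurs in every segment of some fixed length `l`. -/
def StronglyAP {A : Type*} (ω : ℕ → A) : Prop :=
  ∀ x : List A, (∃ i, OccursAt ω x i) →
    ∃ l, ∀ i, ∃ j, i ≤ j ∧ j + x.length ≤ i + l ∧ OccursAt ω x j

/-- The sequence `aν` obtained by prepending the finite string `a` to the sequence `ν`. -/
def appendSeq {A : Type*} (a : List A) (ν : ℕ → A) : ℕ → A :=
  fun n => if h : n < a.length then a[n]'h else ν (n - a.length)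

/-- A sequence is eventually strongly almost periodic if it equals `aν` for some finite
string `a` and strongly almost periodic sequence `ν`. -/
def EventuallySAP {A : Type*} (ω : ℕ → A) : Prop :=
  ∃ (a : List A) (ν : ℕ → A), StronglyAP ν ∧ ω = appendSeq a ν

/-- The bitwise complement of a binary string: every `0` is changed to `1` and vice versa. -/
def bcomp (x : List Bool) : List Bool := x.map (fun b => !b)

/-- The strings `a₀ = 1`, `a_{n+1} = aₙ āₙ āₙ aₙ aₙ`. -/
def aStr : ℕ → List Bool
  | 0 => [true]
  | n + 1 => aStr n ++ bcomp (aStr n) ++ bcomp (aStr n) ++ aStr n ++ aStr n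

/-- The string `cₙ`: the concatenation of 10 copies of `aₙ`. -/
def cStr (n : ℕ) : List Bool := (List.replicate 10 (aStr n)).flatten

/-- The finite prefix `c₀c₁…c_{n-1}` of `ω`; its length is `lₙ = (5/2)(5ⁿ − 1)`. -/
def prefixStr (n : ℕ) : List Bool := (List.ofFn fun k : Fin n => cStr k).flatten

/-- The sequence `ω = c₀c₁c₂c₃…` (the `m`-th symbol lies in the prefix
`c₀…c_m`, which has length greater than `m`). -/
def omegaSeq (m : ℕ) : Bool := (prefixStr (m + 1)).getD m false

theorem length_bcomp (x : List Bool) : (bcomp x).length = x.length := by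
  simp [bcomp]

theorem length_aStr (n : ℕ) : (aStr n).length = 5 ^ n := by
  induction n with
  | zero => rfl
  | succ n ih => simp only [aStr, List.length_append, length_bcomp, ih]; ring

theorem length_cStr (n : ℕ) : (cStr n).length = 10 * 5 ^ n := by
  simp [cStr, length_aStr]
  ring

theorem prefixStr_succ (n : ℕ) : prefixStr (n + 1) = prefixStr n ++ cStr n := by
  rw [prefixStr, List.ofFn_succ_last]
  simp [prefixStr]

theorem le_length_prefixStr (n : ℕ) : n ≤ (prefixStr n).length := by
  induction n with
  | zero => exact Nat.zero_le _
  | succ n ih =>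
    have : 0 < 5 ^ n := by positivity
    rw [prefixStr_succ, List.length_append, length_cStr]
    omega

theorem prefixStr_prefix {m n : ℕ} (h : m ≤ n) : prefixStr m <+: prefixStr n := by
  induction n, h using Nat.le_induction with
  | base => exact List.prefix_rfl
  | succ n _ ih => exact ih.trans (prefixStr_succ n ▸ List.prefix_append _ _)

theorem getElem?_prefixStr {n i : ℕ} (h : i < (prefixStr n).length) :
    (prefixStr n)[i]? = some (omegaSeq i) := by
  have hi : i < (prefixStr (i + 1)).length := le_length_prefixStr (i + 1)
  have hω : (prefixStr (i + 1))[i]? = some (omegaSeq i) := by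
    simp [omegaSeq, List.getD, List.getElem?_eq_getElem hi]
  rw [← hω]
  rcases le_total n (i + 1) with hle | hle
  · exact (List.prefix_iff_getElem?.1 (prefixStr_prefix hle) i h ▸ List.getElem?_eq_getElem h)
  · exact (List.prefix_iff_getElem?.1 (prefixStr_prefix hle) i hi).trans
      (List.getElem?_eq_getElem hi).symm

theorem getElem?_cStr {n r : ℕ} (h : r < (cStr n).length) :
    (cStr n)[r]? = some (omegaSeq ((prefixStr n).length + r)) := by
  have hlt : (prefixStr n).length + r < (prefixStr (n + 1)).length := by
    rw [prefixStr_succ, List.length_append]; omega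
  rw [← getElem?_prefixStr hlt, prefixStr_succ, List.getElem?_append_right (by omega)]
  simp

theorem cStr_periodic {n r : ℕ} (h : r < 9 * 5 ^ n) : (cStr n)[r + 5 ^ n]? = (cStr n)[r]? := by
  have hl : cStr n = aStr n ++ (List.replicate 9 (aStr n)).flatten := by
    rw [cStr, List.replicate_succ, List.flatten_cons]
  have hr : cStr n = (List.replicate 9 (aStr n)).flatten ++ aStr n := by
    rw [cStr, List.replicate_succ', List.flatten_append, List.flatten_singleton]
  have hlen : ((List.replicate 9 (aStr n)).flatten).length = 9 * 5 ^ n := by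
    simp [length_aStr]
    ring
  conv_lhs => rw [hl]
  conv_rhs => rw [hr]
  rw [List.getElem?_append_right (by rw [length_aStr]; omega),
    List.getElem?_append_left (by omega), length_aStr, Nat.add_sub_cancel]

/-- The word splits into blocks of length `5 ^ (n + 1)`, in each of which the symbols at
positions `0` and `5 ^ n` differ. -/
def FlipsAt (n : ℕ) (w : List Bool) : Prop :=
  5 ^ (n + 1) ∣ w.length ∧
    ∀ q, w[5 ^ (n + 1) * q + 5 ^ n]? = w[5 ^ (n + 1) * q]?.map (fun b => !b)

theorem FlipsAt.bcomp {n : ℕ} {w : List Bool} (h : FlipsAt n w) : FlipsAt n (bcomp w) :=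
  ⟨by rw [length_bcomp]; exact h.1, fun q => by simp [_root_.bcomp, h.2 q]⟩

theorem FlipsAt.append {n : ℕ} {v w : List Bool} (hv : FlipsAt n v) (hw : FlipsAt n w) :
    FlipsAt n (v ++ w) := by
  refine ⟨by rw [List.length_append]; exact dvd_add hv.1 hw.1, fun q => ?_⟩
  obtain ⟨s, hs⟩ := hv.1
  have hlt : 5 ^ n < 5 ^ (n + 1) := Nat.pow_lt_pow_right (by norm_num) (by omega)
  rcases lt_or_ge q s with hq | hq
  · have := Nat.mul_le_mul_left (5 ^ (n + 1)) (Nat.succ_le_of_lt hq)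
    rw [Nat.mul_succ] at this
    rw [List.getElem?_append_left (by omega), List.getElem?_append_left (by omega), hv.2]
  · obtain ⟨t, rfl⟩ := Nat.exists_eq_add_of_le hq
    rw [Nat.mul_add, List.getElem?_append_right (by omega),
      List.getElem?_append_right (by omega), hs, Nat.add_sub_cancel_left, Nat.add_assoc,
      Nat.add_sub_cancel_left, hw.2]

theorem flipsAt_aStr_succ (n : ℕ) : FlipsAt n (aStr (n + 1)) := by
  refine ⟨by rw [length_aStr], fun q => ?_⟩
  have hp : 0 < 5 ^ n := by positivity
  rcases q with _ | q
  · have h : aStr (n + 1) =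
        aStr n ++ (bcomp (aStr n) ++ (bcomp (aStr n) ++ aStr n ++ aStr n)) := by
      simp [aStr]
    rw [h, Nat.mul_zero, Nat.zero_add, List.getElem?_append_right (by rw [length_aStr]),
      List.getElem?_append_left (by rw [length_bcomp, length_aStr]; omega),
      List.getElem?_append_left (by rw [length_aStr]; omega), length_aStr]
    simp [bcomp]
  · rw [Nat.mul_succ, List.getElem?_eq_none (by rw [length_aStr]; omega),
      List.getElem?_eq_none (by rw [length_aStr]; omega)]
    rfl

theorem flipsAt_aStr {n m : ℕ} (h : n + 1 ≤ m) : FlipsAt n (aStr m) := by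
  induction m, h using Nat.le_induction with
  | base => exact flipsAt_aStr_succ n
  | succ m _ ih => exact (((ih.append ih.bcomp).append ih.bcomp).append ih).append ih

theorem flipsAt_cStr {n m : ℕ} (h : n + 1 ≤ m) : FlipsAt n (cStr m) := by
  have hrep : ∀ k, FlipsAt n (List.replicate k (aStr m)).flatten := by
    intro k
    induction k with
    | zero => exact ⟨by simp, by simp⟩
    | succ k ih =>
      rw [List.replicate_succ, List.flatten_cons]
      exact (flipsAt_aStr h).append ih
  exact hrep 10

theorem occursAt_iff {A : Type*} {ω : ℕ → A} {x : List A} {i : ℕ} :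
    OccursAt ω x i ↔ ∀ k < x.length, x[k]? = some (ω (i + k)) := by
  unfold OccursAt seg
  constructor
  · intro h k hk
    rw [← h]
    simp [hk]
  · intro h
    refine List.ext_getElem (by simp) fun k _ hk => ?_
    have := h k hk
    rw [List.getElem?_eq_getElem hk] at this
    simpa using (Option.some.inj this).symm

theorem appendSeq_add_length {A : Type*} (a : List A) (ν : ℕ → A) (n : ℕ) :
    appendSeq a ν (n + a.length) = ν n := by
  simp [appendSeq]

/-- The sequence `ω = c₀c₁c₂c₃…`, where `cₙ` is the concatenation of 10 copies of `aₙ`,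
`a₀ = 1` and `a_{n+1} = aₙ āₙ āₙ aₙ aₙ`, is not eventually strongly almost periodic:
for every finite string `a` and strongly almost periodic sequence `ν`, `ω ≠ aν`. -/
theorem omegaSeq_not_eventuallySAP :
    ∀ (a : List Bool) (ν : ℕ → Bool), StronglyAP ν → omegaSeq ≠ appendSeq a ν := by
  intro a ν hν heq
  have hshift : ∀ k, ν k = omegaSeq (k + a.length) := fun k => by
    rw [heq, appendSeq_add_length]
  set n := a.length with hn
  have hpre := le_length_prefixStr n
  obtain ⟨l, hl⟩ := hν (cStr n) ⟨(prefixStr n).length - n, occursAt_iff.2 fun k hk => by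
    rw [hshift, getElem?_cStr hk]; congr 2; omega⟩
  set m := n + 1 + l with hm
  have hprem := le_length_prefixStr m
  obtain ⟨j, hij, hjl, hocc⟩ := hl ((prefixStr m).length - n)
  obtain ⟨e, rfl⟩ := Nat.exists_eq_add_of_le hij
  rw [occursAt_iff] at hocc
  rw [length_cStr] at hocc hjl
  have hlen : l < (cStr m).length := by
    have h1 : l < 5 ^ l := Nat.lt_pow_self (by norm_num)
    have h2 : 5 ^ l ≤ 5 ^ m := Nat.pow_le_pow_right (by norm_num) (by omega)
    rw [length_cStr]
    omega
  have hd : 5 ^ (n + 1) = 5 * 5 ^ n := by ring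
  have hpos : 0 < 5 ^ (n + 1) := by positivity
  -- the first block boundary of `cStr m` after the start of the occurrence
  obtain ⟨q, s, hqs, hs⟩ : ∃ q s, 5 ^ (n + 1) * q = e + s ∧ s ≤ 5 ^ (n + 1) := by
    have h1 := Nat.div_add_mod e (5 ^ (n + 1))
    have h2 := Nat.mod_lt e hpos
    refine ⟨e / 5 ^ (n + 1) + 1, 5 ^ (n + 1) - e % 5 ^ (n + 1), ?_, Nat.sub_le _ _⟩
    rw [Nat.mul_succ]
    omega
  have hcopy : ∀ k < 10 * 5 ^ n, (cStr m)[e + k]? = (cStr n)[k]? := fun k hk => by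
    rw [hocc k hk, getElem?_cStr (by omega), hshift]
    congr 2
    omega
  have hflip := (flipsAt_cStr (n := n) (m := m) (by omega)).2 q
  rw [hqs, Nat.add_assoc, hcopy _ (by omega), hcopy _ (by omega),
    cStr_periodic (by omega), hocc s (by omega)] at hflip
  simp at hflip
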